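/- arXiv:2605.00795 — 2 statements merged into one kernel-verified Lean document; each statement's English description precedes it below -/
import Mathlib

section
/- Let n ≥ 2 be an integer, γ > n real, α = (γ-1)/(n-1), and let θ ∈ ℝ satisfy θ + α(n-2) > -1. Then the boundary integral ∫_{∂Ω_γ} x_n^θ dH^{n-1}(x) is finite, where ∂Ω_γ is the topological boundary of the outward γ-cuspidal domain Ω_γ. -/
open MeasureTheory ENNReal

noncomputable section

/-- The outward `γ`-cuspidal domain `Ω_γ`. -/
def cuspDomain (n : ℕ) (hn : 2 ≤ n) (γ : ℝ) : Set (EuclideanSpace ℝ (Fin n)) :=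
  {x | 0 < x ⟨n - 1, by omega⟩ ∧ x ⟨n - 1, by omega⟩ < 1 ∧
    ∀ i : Fin n, (i : ℕ) < n - 1 →
      0 < x i ∧ x i < x ⟨n - 1, by omega⟩ ^ ((γ - 1) / ((n : ℝ) - 1))}


/-- Measure bound for graphs over boxes. -/
lemma meas_graph (m : ℕ) (i : Fin (m+1)) (K : NNReal) (hK : 1 ≤ K) :
    ∃ C : NNReal, ∀ (a b : Fin m → ℝ) (g : (Fin m → ℝ) → ℝ)
      (_ : LipschitzOnWith K g (Set.Icc a b)) (S : Set (EuclideanSpace ℝ (Fin (m+1))))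
      (_ : ∀ x ∈ S, (fun j => x (i.succAbove j)) ∈ Set.Icc a b ∧
        x i = g (fun j => x (i.succAbove j))),
      μH[(m:ℝ)] S ≤ C * ∏ j, ENNReal.ofReal (b j - a j) := by
  obtain ⟨L, hL⟩ : ∃ L : NNReal, LipschitzWith L
      (WithLp.toLp 2 : (Fin (m+1) → ℝ) → EuclideanSpace ℝ (Fin (m+1))) :=
    ⟨_, PiLp.lipschitzWith_toLp 2 _⟩
  refine ⟨(L * K) ^ (m : ℝ), fun a b g hg S hS => ?_⟩
  set F : (Fin m → ℝ) → (Fin (m+1) → ℝ) := fun y => i.insertNth (g y) y with hF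
  have hFL : LipschitzOnWith K F (Set.Icc a b) := by
    refine LipschitzOnWith.of_dist_le_mul fun x hx y hy => ?_
    rw [dist_pi_le_iff (by positivity)]
    rw [i.forall_iff_succAbove]
    refine ⟨?_, fun j => ?_⟩
    · simpa [hF] using hg.dist_le_mul x hx y hy
    · simp only [hF, Fin.insertNth_apply_succAbove]
      have h1 := dist_le_pi_dist x y j
      have h2 : (1:ℝ) ≤ K := by exact_mod_cast hK
      nlinarith [dist_nonneg (x := x) (y := y)]
  have hG := hL.comp_lipschitzOnWith hFL
  have hsub : S ⊆ (WithLp.toLp 2 ∘ F) '' Set.Icc a b := by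
    intro x hx
    obtain ⟨h1, h2⟩ := hS x hx
    refine ⟨_, h1, ?_⟩
    ext j
    revert j
    rw [i.forall_iff_succAbove]
    simp [hF, h2]
  calc μH[(m:ℝ)] S ≤ μH[(m:ℝ)] ((WithLp.toLp 2 ∘ F) '' Set.Icc a b) := measure_mono hsub
    _ ≤ _ := hG.hausdorffMeasure_image_le (Nat.cast_nonneg m)
    _ = _ := by
      have := hausdorffMeasure_pi_real (ι := Fin m)
      rw [Fintype.card_fin] at this
      rw [this, Real.volume_Icc_pi, ENNReal.coe_rpow_of_nonneg _ (Nat.cast_nonneg m)]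

lemma lip_rpow (α : ℝ) (hα : 1 < α) :
    LipschitzOnWith (Real.toNNReal α) (fun t : ℝ => t ^ α) (Set.Icc 0 1) := by
  refine (convex_Icc (0:ℝ) 1).lipschitzOnWith_of_nnnorm_hasDerivWithin_le
    (f' := fun t => α * t ^ (α - 1))
    (fun x _ => (Real.hasDerivAt_rpow_const (Or.inr hα.le)).hasDerivWithinAt) ?_
  intro x hx
  rw [← NNReal.coe_le_coe, coe_nnnorm, Real.coe_toNNReal _ (by linarith), Real.norm_eq_abs,
    abs_of_nonneg (mul_nonneg (by linarith) (Real.rpow_nonneg hx.1 _))]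
  have := Real.rpow_le_one hx.1 hx.2 (by linarith : 0 ≤ α - 1)
  nlinarith

lemma rpow_slab (θ x s : ℝ) (hs : 0 < s) (h1 : s * (1/2) < x) (h2 : x ≤ s) :
    x ^ θ ≤ max 1 ((1/2 : ℝ) ^ θ) * s ^ θ := by
  have hx : 0 < x := by linarith
  have hsp := Real.rpow_pos_of_pos hs θ
  rcases le_or_gt 0 θ with h | h
  · calc x ^ θ ≤ 1 * s ^ θ := by rw [one_mul]; exact Real.rpow_le_rpow hx.le h2 h
      _ ≤ _ := by gcongr; exact le_max_left _ _
  · calc x ^ θ ≤ (s * (1/2)) ^ θ :=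
          Real.rpow_le_rpow_of_nonpos (by positivity) h1.le h.le
      _ = (1/2 : ℝ) ^ θ * s ^ θ := by rw [Real.mul_rpow hs.le (by norm_num), mul_comm]
      _ ≤ _ := by gcongr; exact le_max_right _ _

lemma lateral (m : ℕ) (hm : 1 ≤ m) (α θ : ℝ) (hα : 1 < α)
    (hθ : θ + α * ((m:ℝ) - 1) > -1) (i : Fin (m+1)) (hi : i ≠ Fin.last m)
    (g : ℝ → ℝ) (K : NNReal) (hK : 1 ≤ K) (hg : LipschitzOnWith K g (Set.Icc 0 1)) :
    ∫⁻ x in {x : EuclideanSpace ℝ (Fin (m+1)) | 0 < x (Fin.last m) ∧ x (Fin.last m) ≤ 1 ∧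
      (∀ j, j ≠ Fin.last m → 0 ≤ x j ∧ x j ≤ x (Fin.last m) ^ α) ∧ x i = g (x (Fin.last m))},
      ENNReal.ofReal (x (Fin.last m) ^ θ) ∂(μH[(m:ℝ)]) < ⊤ := by
  obtain ⟨l, hl⟩ := Fin.exists_succAbove_eq hi.symm
  obtain ⟨C, hC⟩ := meas_graph m i K hK
  set S : ℕ → Set (EuclideanSpace ℝ (Fin (m+1))) := fun k =>
    {x | (1/2:ℝ)^(k+1) < x (Fin.last m) ∧ x (Fin.last m) ≤ (1/2:ℝ)^k ∧
      (∀ j, j ≠ Fin.last m → 0 ≤ x j ∧ x j ≤ x (Fin.last m) ^ α) ∧ x i = g (x (Fin.last m))}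
    with hS
  set M : ℝ := max 1 ((1/2 : ℝ) ^ θ) with hM
  set q : ℝ := (1/2 : ℝ) ^ (θ + 1 + α * ((m:ℝ) - 1)) with hq
  have hM0 : 0 ≤ M := le_trans zero_le_one (le_max_left _ _)
  have key : ∀ k, ∫⁻ x in S k, ENNReal.ofReal (x (Fin.last m) ^ θ) ∂(μH[(m:ℝ)]) ≤
      (ENNReal.ofReal M * C) * ENNReal.ofReal q ^ k := by
    intro k
    set s : ℝ := (1/2:ℝ)^k with hs
    have hs0 : 0 < s := by positivity
    have hs1 : s ≤ 1 := pow_le_one₀ (by norm_num) (by norm_num)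
    have hss : (1/2:ℝ)^(k+1) = s * (1/2) := pow_succ _ _
    have hmeas : μH[(m:ℝ)] (S k) ≤ C * (ENNReal.ofReal (s * (s ^ α) ^ (m-1))) := by
      refine (hC (fun j => if j = l then s * (1/2) else 0) (fun j => if j = l then s else s ^ α)
        (fun y => g (y l)) ?_ (S k) ?_).trans ?_
      · refine LipschitzOnWith.of_dist_le_mul fun x hx y hy => ?_
        have hmem : ∀ z ∈ Set.Icc (fun j => if j = l then s * (1/2) else 0)
            (fun j => if j = l then s else s ^ α), z l ∈ Set.Icc (0:ℝ) 1 := by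
          intro z hz
          have h1 := hz.1 l
          have h2 := hz.2 l
          simp only [if_true] at h1 h2
          constructor <;> linarith
        refine (hg.dist_le_mul _ (hmem x hx) _ (hmem y hy)).trans ?_
        gcongr
        exact dist_le_pi_dist x y l
      · rintro x ⟨h1, h2, h3, h4⟩
        rw [hss] at h1
        refine ⟨⟨fun j => ?_, fun j => ?_⟩, ?_⟩
        · by_cases hj : j = l
          · subst hj; simp only [if_true, hl]; exact h1.le
          · simp only [hj, if_false]
            refine (h3 _ ?_).1
            rw [← hl]; exact fun h => hj (Fin.succAbove_right_injective h)
        · by_cases hj : j = l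
          · subst hj; simp only [if_true, hl]; exact h2
          · simp only [hj, if_false]
            refine (h3 _ ?_).2.trans (Real.rpow_le_rpow (by linarith) h2 (by linarith))
            rw [← hl]; exact fun h => hj (Fin.succAbove_right_injective h)
        · simp only [hl]; exact h4
      · gcongr
        rw [← ENNReal.ofReal_prod_of_nonneg]
        · apply ENNReal.ofReal_le_ofReal
          rw [← Finset.mul_prod_erase Finset.univ _ (Finset.mem_univ l)]
          simp only [if_true]
          have : ∏ x ∈ Finset.univ.erase l, ((if x = l then s else s ^ α) -
              (if x = l then s * (1/2) else 0)) = (s ^ α) ^ (m-1) := by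
            rw [Finset.prod_congr rfl (g := fun _ => s ^ α)]
            · simp
            · intro j hj
              simp [Finset.ne_of_mem_erase hj]
          rw [this]
          gcongr
          linarith
        · intro j _
          by_cases hj : j = l
          · simp only [hj, if_true]; linarith
          · simp only [hj, if_false]; have := Real.rpow_nonneg hs0.le α; linarith
    have hqk : s ^ θ * (s * (s ^ α) ^ (m-1)) = q ^ k := by
      have h2 : (s ^ α) ^ (m-1) = s ^ (α * ((m:ℝ) - 1)) := by
        rw [← Real.rpow_natCast, ← Real.rpow_mul hs0.le, Nat.cast_sub hm, Nat.cast_one]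
      rw [h2]
      nth_rw 2 [← Real.rpow_one s]
      rw [← Real.rpow_add hs0, ← Real.rpow_add hs0, hq, hs, ← Real.rpow_natCast,
        ← Real.rpow_natCast, ← Real.rpow_mul (by norm_num), ← Real.rpow_mul (by norm_num)]
      congr 1; ring
    calc ∫⁻ x in S k, ENNReal.ofReal (x (Fin.last m) ^ θ) ∂(μH[(m:ℝ)])
        ≤ ∫⁻ x in S k, ENNReal.ofReal (M * s ^ θ) ∂(μH[(m:ℝ)]) := by
          refine setLIntegral_mono measurable_const ?_
          rintro x ⟨h1, h2, -, -⟩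
          rw [hss] at h1
          exact ENNReal.ofReal_le_ofReal (rpow_slab θ _ s hs0 h1 h2)
      _ = ENNReal.ofReal (M * s ^ θ) * μH[(m:ℝ)] (S k) := setLIntegral_const _ _
      _ ≤ ENNReal.ofReal (M * s ^ θ) * (C * (ENNReal.ofReal (s * (s ^ α) ^ (m-1)))) := by gcongr
      _ = (ENNReal.ofReal M * C) *
          (ENNReal.ofReal (s ^ θ) * ENNReal.ofReal (s * (s ^ α) ^ (m-1))) := by
          rw [ENNReal.ofReal_mul hM0]; ring
      _ = _ := by
          rw [← ENNReal.ofReal_mul (Real.rpow_nonneg hs0.le _), hqk,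
            ENNReal.ofReal_pow (Real.rpow_nonneg (by norm_num) _)]
  have hq1 : q < 1 := Real.rpow_lt_one (by norm_num) (by norm_num) (by linarith)
  calc _ ≤ ∫⁻ x in ⋃ k, S k, ENNReal.ofReal (x (Fin.last m) ^ θ) ∂(μH[(m:ℝ)]) := by
        refine lintegral_mono_set ?_
        rintro x ⟨h1, h2, h3, h4⟩
        obtain ⟨k, hk1, hk2⟩ := exists_nat_pow_near_of_lt_one h1 h2
          (by norm_num : (0:ℝ) < 1/2) (by norm_num)
        exact Set.mem_iUnion.2 ⟨k, hk1, hk2, h3, h4⟩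
    _ ≤ ∑' k, ∫⁻ x in S k, ENNReal.ofReal (x (Fin.last m) ^ θ) ∂(μH[(m:ℝ)]) :=
        lintegral_iUnion_le _ _
    _ ≤ ∑' k : ℕ, (ENNReal.ofReal M * C) * ENNReal.ofReal q ^ k := ENNReal.tsum_le_tsum key
    _ < ⊤ := by
        rw [ENNReal.tsum_mul_left, ENNReal.tsum_geometric]
        refine ENNReal.mul_lt_top (ENNReal.mul_lt_top ENNReal.ofReal_lt_top ENNReal.coe_lt_top) ?_
        rw [ENNReal.inv_lt_top, tsub_pos_iff_lt]
        exact ENNReal.ofReal_lt_one.2 hq1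

lemma topFace (m : ℕ) (α θ : ℝ) :
    ∫⁻ x in {x : EuclideanSpace ℝ (Fin (m+1)) | x (Fin.last m) = 1 ∧
      (∀ j, j ≠ Fin.last m → 0 ≤ x j ∧ x j ≤ x (Fin.last m) ^ α)},
      ENNReal.ofReal (x (Fin.last m) ^ θ) ∂(μH[(m:ℝ)]) < ⊤ := by
  obtain ⟨C, hC⟩ := meas_graph m (Fin.last m) 1 le_rfl
  set S := {x : EuclideanSpace ℝ (Fin (m+1)) | x (Fin.last m) = 1 ∧
      (∀ j, j ≠ Fin.last m → 0 ≤ x j ∧ x j ≤ x (Fin.last m) ^ α)} with hS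
  have h := hC 0 1 (fun _ => 1) (LipschitzOnWith.of_dist_le_mul fun x _ y _ => by simp) S (by
    rintro x ⟨h1, h2⟩
    have h3 : ∀ j : Fin m, 0 ≤ x ((Fin.last m).succAbove j) ∧ x ((Fin.last m).succAbove j) ≤ 1 := by
      intro j
      have := h2 _ (Fin.succAbove_ne (Fin.last m) j)
      rwa [h1, Real.one_rpow] at this
    exact ⟨⟨fun j => (h3 j).1, fun j => (h3 j).2⟩, h1⟩)
  calc _ ≤ ∫⁻ x in S, 1 ∂(μH[(m:ℝ)]) := by
        refine setLIntegral_mono measurable_const ?_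
        rintro x ⟨h1, -⟩
        simp [h1]
    _ = μH[(m:ℝ)] S := setLIntegral_one _
    _ ≤ _ := h
    _ < ⊤ := by simp

lemma frontier_sub (m : ℕ) (hn : 2 ≤ m + 1) (γ α : ℝ) (hα : 1 < α)
    (hγ : (γ - 1) / (((m+1 : ℕ) : ℝ) - 1) = α) :
    ∀ x ∈ frontier (cuspDomain (m+1) hn γ),
      0 ≤ x (Fin.last m) ∧ x (Fin.last m) ≤ 1 ∧
      (∀ j, j ≠ Fin.last m → 0 ≤ x j ∧ x j ≤ x (Fin.last m) ^ α) ∧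
      (x (Fin.last m) = 0 ∨ x (Fin.last m) = 1 ∨ 
        ∃ i, i ≠ Fin.last m ∧ (x i = 0 ∨ x i = x (Fin.last m) ^ α)) := by
  have hD : cuspDomain (m+1) hn γ = {x | 0 < x (Fin.last m) ∧ x (Fin.last m) < 1 ∧
      ∀ j, j ≠ Fin.last m → 0 < x j ∧ x j < x (Fin.last m) ^ α} := by
    ext x
    simp only [cuspDomain, hγ, Set.mem_ofPred_eq]
    refine and_congr Iff.rfl (and_congr Iff.rfl (forall_congr' fun j => ?_))
    have : (j : ℕ) < m + 1 - 1 ↔ j ≠ Fin.last m := by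
      rw [← Fin.lt_last_iff_ne_last, Fin.lt_def]; simp
    rw [this]
    rfl
  have hc : ∀ j, Continuous fun x : EuclideanSpace ℝ (Fin (m+1)) => x j := fun j => by fun_prop
  have hp : Continuous fun x : EuclideanSpace ℝ (Fin (m+1)) => x (Fin.last m) ^ α :=
    (hc _).rpow_const fun _ => Or.inr (by linarith)
  have hopen : IsOpen (cuspDomain (m+1) hn γ) := by
    rw [hD]
    have : {x : EuclideanSpace ℝ (Fin (m+1)) | 0 < x (Fin.last m) ∧ x (Fin.last m) < 1 ∧
      ∀ j, j ≠ Fin.last m → 0 < x j ∧ x j < x (Fin.last m) ^ α} =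
      {x | 0 < x (Fin.last m)} ∩ ({x | x (Fin.last m) < 1} ∩
        ⋂ j, {x | j ≠ Fin.last m → 0 < x j ∧ x j < x (Fin.last m) ^ α}) := by
      ext x; simp
    rw [this]
    refine (isOpen_lt continuous_const (hc _)).inter
      ((isOpen_lt (hc _) continuous_const).inter (isOpen_iInter_of_finite fun j => ?_))
    by_cases hj : j = Fin.last m
    · simp [hj]
    · simp only [ne_eq, hj, not_false_eq_true, true_imp_iff]
      exact (isOpen_lt continuous_const (hc _)).inter (isOpen_lt (hc _) hp)
  have hclosed : IsClosed {x : EuclideanSpace ℝ (Fin (m+1)) | 0 ≤ x (Fin.last m) ∧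
      x (Fin.last m) ≤ 1 ∧ ∀ j, j ≠ Fin.last m → 0 ≤ x j ∧ x j ≤ x (Fin.last m) ^ α} := by
    have : {x : EuclideanSpace ℝ (Fin (m+1)) | 0 ≤ x (Fin.last m) ∧ x (Fin.last m) ≤ 1 ∧
      ∀ j, j ≠ Fin.last m → 0 ≤ x j ∧ x j ≤ x (Fin.last m) ^ α} =
      {x | 0 ≤ x (Fin.last m)} ∩ ({x | x (Fin.last m) ≤ 1} ∩
        ⋂ j, {x | j ≠ Fin.last m → 0 ≤ x j ∧ x j ≤ x (Fin.last m) ^ α}) := by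
      ext x; simp
    rw [this]
    refine (isClosed_le continuous_const (hc _)).inter
      ((isClosed_le (hc _) continuous_const).inter (isClosed_iInter fun j => ?_))
    by_cases hj : j = Fin.last m
    · simp [hj]
    · simp only [ne_eq, hj, not_false_eq_true, true_imp_iff]
      exact (isClosed_le continuous_const (hc _)).inter (isClosed_le (hc _) hp)
  intro x hx
  rw [hopen.frontier_eq] at hx
  obtain ⟨hx1, hx2⟩ := hx
  have hcl := closure_minimal (t := {x : EuclideanSpace ℝ (Fin (m+1)) | 0 ≤ x (Fin.last m) ∧
      x (Fin.last m) ≤ 1 ∧ ∀ j, j ≠ Fin.last m → 0 ≤ x j ∧ x j ≤ x (Fin.last m) ^ α})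
    (by rw [hD]
        rintro y ⟨h1, h2, h3⟩
        exact ⟨h1.le, h2.le, fun j hj => ⟨(h3 j hj).1.le, (h3 j hj).2.le⟩⟩) hclosed hx1
  obtain ⟨h1, h2, h3⟩ := hcl
  refine ⟨h1, h2, h3, ?_⟩
  by_contra! hcon
  obtain ⟨c1, c2, c3⟩ := hcon
  apply hx2
  rw [hD]
  exact ⟨lt_of_le_of_ne h1 (Ne.symm c1), lt_of_le_of_ne h2 c2, fun j hj =>
    ⟨lt_of_le_of_ne (h3 j hj).1 (Ne.symm (c3 j hj).1), lt_of_le_of_ne (h3 j hj).2 (c3 j hj).2⟩⟩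

/-- If `θ + α(n-2) > -1`, `α = (γ-1)/(n-1)`, then the boundary integral
`∫_{∂Ω_γ} x_n^θ dH^{n-1}` is finite. -/
theorem boundary_power_integral_finite
    (n : ℕ) (hn : 2 ≤ n) (γ θ : ℝ) (hγ : (n : ℝ) < γ)
    (hθ : θ + ((γ - 1) / ((n : ℝ) - 1)) * ((n : ℝ) - 2) > -1) :
    ∫⁻ x in frontier (cuspDomain n hn γ),
      ENNReal.ofReal (x ⟨n - 1, by omega⟩ ^ θ) ∂(μH[(n : ℝ) - 1]) < ⊤ := by
  obtain ⟨m, rfl⟩ : ∃ m, n = m + 1 := ⟨n - 1, by omega⟩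
  have hm : 1 ≤ m := by omega
  have hm' : (1:ℝ) ≤ m := by exact_mod_cast hm
  have hcast : ((m+1 : ℕ) : ℝ) - 1 = m := by push_cast; ring
  obtain ⟨α, hαdef⟩ : ∃ α, (γ - 1) / (((m+1 : ℕ) : ℝ) - 1) = α := ⟨_, rfl⟩
  have hα : 1 < α := by
    rw [← hαdef, hcast, lt_div_iff₀ (by linarith)]
    push_cast at hγ; linarith
  have hfr := frontier_sub m hn γ α hα hαdef
  rw [hαdef] at hθ
  have hθ' : θ + α * ((m:ℝ) - 1) > -1 := by
    push_cast at hθ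
    convert hθ using 3; ring
  rw [hcast]
  change ∫⁻ x in frontier (cuspDomain (m+1) hn γ),
      ENNReal.ofReal (x (Fin.last m) ^ θ) ∂(μH[(m : ℝ)]) < ⊤
  set T := {x : EuclideanSpace ℝ (Fin (m+1)) | x (Fin.last m) = 1 ∧
      (∀ j, j ≠ Fin.last m → 0 ≤ x j ∧ x j ≤ x (Fin.last m) ^ α)} with hT
  set G : (ℝ → ℝ) → Fin (m+1) → Set (EuclideanSpace ℝ (Fin (m+1))) := fun g i =>
    {x | 0 < x (Fin.last m) ∧ x (Fin.last m) ≤ 1 ∧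
      (∀ j, j ≠ Fin.last m → 0 ≤ x j ∧ x j ≤ x (Fin.last m) ^ α) ∧ x i = g (x (Fin.last m))}
    with hG
  have hsub : frontier (cuspDomain (m+1) hn γ) ⊆
      ({0} ∪ T) ∪ ((⋃ i : {i : Fin (m+1) // i ≠ Fin.last m}, G (fun _ => 0) i) ∪
        (⋃ i : {i : Fin (m+1) // i ≠ Fin.last m}, G (fun t => t ^ α) i)) := by
    intro x hx
    obtain ⟨h1, h2, h3, h4⟩ := hfr x hx
    rcases h1.eq_or_lt with h0 | h0
    · left; left
      rw [Set.mem_singleton_iff]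
      ext j
      by_cases hj : j = Fin.last m
      · rw [hj, ← h0]; simp
      · have := h3 j hj
        rw [← h0, Real.zero_rpow (by linarith)] at this
        exact le_antisymm this.2 this.1
    · rcases h4 with h | h | ⟨i, hi, h | h⟩
      · linarith
      · left; right; exact ⟨h, h3⟩
      · right; left; exact Set.mem_iUnion.2 ⟨⟨i, hi⟩, h0, h2, h3, h⟩
      · right; right; exact Set.mem_iUnion.2 ⟨⟨i, hi⟩, h0, h2, h3, h⟩
  have hU : ∀ (g : ℝ → ℝ) (K : NNReal), 1 ≤ K → LipschitzOnWith K g (Set.Icc 0 1) →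
      ∫⁻ x in ⋃ i : {i : Fin (m+1) // i ≠ Fin.last m}, G g i,
        ENNReal.ofReal (x (Fin.last m) ^ θ) ∂(μH[(m : ℝ)]) < ⊤ := by
    intro g K hK hg
    refine (lintegral_iUnion_le _ _).trans_lt ?_
    rw [tsum_fintype]
    exact ENNReal.sum_lt_top.2 fun i _ => lateral m hm α θ hα hθ' i i.2 g K hK hg
  refine (lintegral_mono_set hsub).trans_lt ?_
  refine (lintegral_union_le _ _ _).trans_lt (ENNReal.add_lt_top.2 ⟨?_, ?_⟩)
  · refine (lintegral_union_le _ _ _).trans_lt (ENNReal.add_lt_top.2 ⟨?_, topFace m α θ⟩)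
    have : μH[(m:ℝ)] ({0} : Set (EuclideanSpace ℝ (Fin (m+1)))) = 0 := by
      have := Measure.nullSingletonClass_hausdorff (EuclideanSpace ℝ (Fin (m+1)))
        (d := (m:ℝ)) (by linarith)
      exact measure_singleton _
    rw [setLIntegral_measure_zero _ _ this]
    exact ENNReal.zero_lt_top
  · refine (lintegral_union_le _ _ _).trans_lt (ENNReal.add_lt_top.2 ⟨?_, ?_⟩)
    · exact hU (fun _ => 0) 1 le_rfl (LipschitzOnWith.of_dist_le_mul fun x _ y _ => by simp)
    · exact hU (fun t => t ^ α) _ (by rw [Real.one_le_toNNReal]; exact hα.le) (lip_rpow α hα)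
end
end

section
/- Let n ≥ 2 be an integer, γ > n real, α = (γ-1)/(n-1), 1 ≤ p < ∞, and let η : ℝ → ℝ be a smooth function with 0 ≤ η ≤ 1, η ≡ 1 on (-∞, 1], and η ≡ 0 on [2, ∞). For 0 < ε < 1/2 define u_ε : ℝ^n → ℝ by u_ε(x) = η(x_n / ε). Then there exists a constant C > 0, depending only on n, α, p, and η, such that for all 0 < ε < 1/2: ∫_{Ω_γ} |u_ε(x)|^p dx ≤ C ε^{α(n-1)+1} and ∫_{Ω_γ} |∇u_ε(x)|^p dx ≤ C ε^{α(n-1)+1-p}. -/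
open MeasureTheory ENNReal

noncomputable section

lemma cusp_aux_volume (n : ℕ) (hn : 2 ≤ n) (γ : ℝ) (hγ : (n : ℝ) < γ) (δ : ℝ) (hδ : 0 < δ) :
    volume ({x : EuclideanSpace ℝ (Fin n) | x ⟨n - 1, by omega⟩ ≤ δ} ∩ cuspDomain n hn γ) ≤
      ENNReal.ofReal (δ ^ (((γ - 1) / ((n : ℝ) - 1)) * ((n : ℝ) - 1) + 1)) := by
  obtain ⟨m, rfl⟩ : ∃ m, n = m + 1 := ⟨n - 1, by omega⟩
  have hm : 1 ≤ m := by omega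
  have hm' : (1 : ℝ) ≤ m := by exact_mod_cast hm
  have hα : 0 ≤ (γ - 1) / (((m + 1 : ℕ) : ℝ) - 1) := by
    push_cast at hγ ⊢
    apply div_nonneg <;> linarith
  set α := (γ - 1) / (((m + 1 : ℕ) : ℝ) - 1) with hαdef
  let b : Fin (m + 1) → ℝ := fun i => if (i : ℕ) < m then δ ^ α else δ
  have hsub : ({x : EuclideanSpace ℝ (Fin (m + 1)) | x ⟨m + 1 - 1, by omega⟩ ≤ δ} ∩
      cuspDomain (m + 1) hn γ) ⊆
      (MeasurableEquiv.toLp 2 (Fin (m + 1) → ℝ)).symm ⁻¹'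
        (Set.pi Set.univ (fun i => Set.Icc 0 (b i))) := by
    rintro x ⟨hx, h0, h1, h2⟩
    simp only [Set.mem_ofPred_eq] at hx
    intro i _
    show 0 ≤ x i ∧ x i ≤ b i
    by_cases hi : (i : ℕ) < m
    · have := h2 i hi
      refine ⟨this.1.le, ?_⟩
      simp only [b, hi, if_true]
      exact this.2.le.trans (Real.rpow_le_rpow h0.le hx hα)
    · have : i = ⟨m + 1 - 1, by omega⟩ := by
        apply Fin.ext; simp; omega
      simp only [b, hi, if_false]
      rw [this]
      exact ⟨h0.le, hx⟩
  refine (measure_mono hsub).trans ?_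
  rw [(EuclideanSpace.volume_preserving_symm_measurableEquiv_toLp (Fin (m + 1))).measure_preimage
    (MeasurableSet.univ_pi (fun i => measurableSet_Icc)).nullMeasurableSet, volume_pi_pi]
  simp only [Real.volume_Icc, sub_zero]
  rw [Fin.prod_univ_castSucc]
  simp only [b, Fin.val_castSucc, Fin.is_lt, if_true, Fin.val_last, lt_irrefl, if_false,
    Finset.prod_const, Finset.card_univ, Fintype.card_fin]
  rw [← ENNReal.ofReal_pow (by positivity), ← ENNReal.ofReal_mul (by positivity)]
  apply le_of_eq
  congr 1
  rw [Real.rpow_add hδ, Real.rpow_one]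
  congr 1
  push_cast
  rw [add_sub_cancel_right, Real.rpow_mul hδ.le, Real.rpow_natCast]

lemma cusp_aux_lintegral (n : ℕ) (hn : 2 ≤ n) (γ : ℝ) (hγ : (n : ℝ) < γ) (δ K : ℝ) (hδ : 0 < δ)
    (hK : 0 ≤ K) (f : EuclideanSpace ℝ (Fin n) → ℝ)
    (h1 : ∀ x, f x ≤ K) (h0 : ∀ x, δ < x ⟨n - 1, by omega⟩ → f x = 0) :
    ∫⁻ x in cuspDomain n hn γ, ENNReal.ofReal (f x) ≤
      ENNReal.ofReal (K * δ ^ (((γ - 1) / ((n : ℝ) - 1)) * ((n : ℝ) - 1) + 1)) := by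
  let T : Set (EuclideanSpace ℝ (Fin n)) := {x | x ⟨n - 1, by omega⟩ ≤ δ}
  have hT : MeasurableSet T := by
    apply IsClosed.measurableSet
    exact isClosed_le (by fun_prop) continuous_const
  calc ∫⁻ x in cuspDomain n hn γ, ENNReal.ofReal (f x)
      ≤ ∫⁻ x in cuspDomain n hn γ, T.indicator (fun _ => ENNReal.ofReal K) x := by
        apply lintegral_mono
        intro x
        by_cases hx : x ∈ T
        · simp only [Set.indicator_of_mem hx]
          exact ENNReal.ofReal_le_ofReal (h1 x)
        · have : f x = 0 := h0 x (not_le.mp hx)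
          simp [this]
    _ = ENNReal.ofReal K * volume (T ∩ cuspDomain n hn γ) := by
        rw [lintegral_indicator_const hT, Measure.restrict_apply hT]
    _ ≤ _ := by
        rw [ENNReal.ofReal_mul hK]
        gcongr
        exact cusp_aux_volume n hn γ hγ δ hδ

/-- Estimates for the cut-off test functions `u_ε(x) = η(x_n/ε)`:
`∫_{Ω_γ} |u_ε|^p ≤ C ε^{α(n-1)+1}` and `∫_{Ω_γ} |∇u_ε|^p ≤ C ε^{α(n-1)+1-p}`
with a constant `C` independent of `ε ∈ (0, 1/2)`, where `α = (γ-1)/(n-1)`. -/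
theorem cutoff_test_function_estimates
    (n : ℕ) (hn : 2 ≤ n) (γ p : ℝ) (hγ : (n : ℝ) < γ)
    (hp1 : 1 ≤ p)
    (η : ℝ → ℝ) (hη : ContDiff ℝ (⊤ : ℕ∞) η)
    (hη01 : ∀ t, 0 ≤ η t ∧ η t ≤ 1)
    (hη1 : ∀ t ≤ (1 : ℝ), η t = 1) (hη0 : ∀ t, (2 : ℝ) ≤ t → η t = 0) :
    ∃ C : ℝ, 0 < C ∧
      ∀ ε : ℝ, 0 < ε → ε < 1 / 2 →
        (∫⁻ x in cuspDomain n hn γ,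
            ENNReal.ofReal (|η (x ⟨n - 1, by omega⟩ / ε)| ^ p) ≤
          ENNReal.ofReal (C * ε ^ (((γ - 1) / ((n : ℝ) - 1)) * ((n : ℝ) - 1) + 1))) ∧
        (∫⁻ x in cuspDomain n hn γ,
            ENNReal.ofReal
              (‖fderiv ℝ (fun z : EuclideanSpace ℝ (Fin n) =>
                  η (z ⟨n - 1, by omega⟩ / ε)) x‖ ^ p) ≤
          ENNReal.ofReal (C * ε ^ (((γ - 1) / ((n : ℝ) - 1)) * ((n : ℝ) - 1) + 1 - p))) := by
  have hηd : Differentiable ℝ η := hη.differentiable (by simp)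
  have hd0 : ∀ t, (2 : ℝ) < t → deriv η t = 0 := by
    intro t ht
    have : η =ᶠ[nhds t] fun _ => 0 := by
      filter_upwards [lt_mem_nhds ht] with s hs using hη0 s hs.le
    rw [this.deriv_eq]; simp
  have hd1 : ∀ t, t < (1 : ℝ) → deriv η t = 0 := by
    intro t ht
    have : η =ᶠ[nhds t] fun _ => 1 := by
      filter_upwards [gt_mem_nhds ht] with s hs using hη1 s hs.le
    rw [this.deriv_eq]; simp
  have hdc : Continuous (deriv η) := hη.continuous_deriv (by simp)
  obtain ⟨M, hM⟩ := (isCompact_Icc (a := (1 : ℝ)) (b := 2)).exists_bound_of_continuousOn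
    hdc.continuousOn
  have hM0 : 0 ≤ M := (norm_nonneg _).trans (hM 1 (by norm_num))
  have hMb : ∀ t, |deriv η t| ≤ M := by
    intro t
    by_cases h1 : t < 1
    · simp [hd1 t h1, hM0]
    by_cases h2 : 2 < t
    · simp [hd0 t h2, hM0]
    exact hM t ⟨not_lt.mp h1, not_lt.mp h2⟩
  have hp0 : p ≠ 0 := by linarith
  set e := ((γ - 1) / ((n : ℝ) - 1)) * ((n : ℝ) - 1) + 1 with he
  refine ⟨(1 + M ^ p) * 2 ^ e, by positivity, ?_⟩
  intro ε hε _
  have hMp : 0 ≤ M ^ p := by positivity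
  have hnorm : ∀ x : EuclideanSpace ℝ (Fin n),
      ‖fderiv ℝ (fun z : EuclideanSpace ℝ (Fin n) => η (z ⟨n - 1, by omega⟩ / ε)) x‖ ≤
        |deriv η (x ⟨n - 1, by omega⟩ / ε)| / ε := by
    intro x
    have hL := (EuclideanSpace.proj (𝕜 := ℝ)
      (⟨n - 1, by omega⟩ : Fin n) : EuclideanSpace ℝ (Fin n) →L[ℝ] ℝ).hasFDerivAt (x := x)
    have hL2 := hL.mul_const (ε⁻¹)
    have hc := (hηd (x ⟨n - 1, by omega⟩ * ε⁻¹)).hasDerivAt.comp_hasFDerivAt x hL2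
    have hc' : HasFDerivAt (fun z : EuclideanSpace ℝ (Fin n) => η (z ⟨n - 1, by omega⟩ / ε)) _ x :=
      hc
    rw [hc'.fderiv]
    refine ContinuousLinearMap.opNorm_le_bound _ (by positivity) ?_
    intro v
    have hv : |v ⟨n - 1, by omega⟩| ≤ ‖v‖ := by
      simpa using PiLp.norm_apply_le v (⟨n - 1, by omega⟩ : Fin n)
    simp only [smul_apply, smul_eq_mul, norm_mul, Real.norm_eq_abs,
      abs_inv, abs_of_pos hε, div_eq_mul_inv]
    rw [mul_assoc]
    gcongr
    exact hv
  constructor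
  · refine (cusp_aux_lintegral n hn γ hγ (2 * ε) 1 (by positivity) zero_le_one _ ?_ ?_).trans ?_
    · intro x
      rw [abs_of_nonneg (hη01 _).1]
      exact Real.rpow_le_one (hη01 _).1 (hη01 _).2 (by linarith)
    · intro x hx
      rw [hη0 _ ((le_div_iff₀ hε).2 hx.le), abs_zero, Real.zero_rpow hp0]
    · apply ENNReal.ofReal_le_ofReal
      rw [← he, Real.mul_rpow (by norm_num) hε.le, mul_assoc]
      gcongr
      linarith
  · refine (cusp_aux_lintegral n hn γ hγ (2 * ε) ((M / ε) ^ p) (by positivity) (by positivity)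
      _ ?_ ?_).trans ?_
    · intro x
      refine Real.rpow_le_rpow (norm_nonneg _) ((hnorm x).trans ?_) (by linarith)
      gcongr
      exact hMb _
    · intro x hx
      have := hnorm x
      rw [hd0 _ ((lt_div_iff₀ hε).2 hx), abs_zero, zero_div] at this
      rw [le_antisymm this (norm_nonneg _), Real.zero_rpow hp0]
    · apply ENNReal.ofReal_le_ofReal
      rw [← he, Real.mul_rpow (by norm_num) hε.le, Real.div_rpow hM0 hε.le, Real.rpow_sub hε]
      have : M ^ p / ε ^ p * (2 ^ e * ε ^ e) = M ^ p * 2 ^ e * (ε ^ e / ε ^ p) := by ring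
      rw [this]
      gcongr
      linarith
end
end
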